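/- Let A be a unital associative ℚ(q)-algebra and a, b, c, d ∈ A satisfying the defining relations of Manin's quantum 2×2 matrix algebra F_q[M_2]: ab = qba, ac = qca, bd = qdb, cd = qdc, bc = cb, ad − da = (q − q^{−1})bc. Set 𝐛 := (q − q^{−1})^{−1} b and 𝐜 := (q − q^{−1})^{−1} c. Then for all n ∈ ℕ, all integers t, and all k with 0 ≤ k < n: {a; t | n, k} · d − d · {a; t | n, k} = q^{t+k−n} (q − q^{−1})² · 𝐜 𝐛 · {a; t | n, k+1}. -/

import Mathlib

open Finset

noncomputable section

/-- The base field `ℚ(q)` of rational functions over `ℚ`. -/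
abbrev K : Type := RatFunc ℚ

/-- The indeterminate `q`. -/
def q : K := RatFunc.X

/-- The `x`-number `(n)_x = (x^n - 1)/(x - 1)`. -/
def qn (x : K) (n : ℕ) : K := (x ^ n - 1) / (x - 1)

/-- The `x`-factorial `(n)_x!`. -/
def qnFact (x : K) (n : ℕ) : K := ∏ r ∈ Finset.Icc 1 n, qn x r

/-- The `x`-binomial coefficient `binom_x(n,s)`, zero when `s > n`. -/
def qBinom (x : K) (n s : ℕ) : K :=
  if s ≤ n then qnFact x n / (qnFact x s * qnFact x (n - s)) else 0

/-- The balanced `q`-integer `[n]_q = (q^n - q^{-n})/(q - q^{-1})`. -/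
def qint (n : ℕ) : K := (q ^ n - q⁻¹ ^ n) / (q - q⁻¹)

/-- The balanced `q`-factorial `[n]_q!`. -/
def qintFact (n : ℕ) : K := ∏ r ∈ Finset.Icc 1 n, qint r

variable {A : Type*} [Ring A] [Algebra K A]

/-- The `q`-divided power `X^{(n)} = X^n / [n]_q!`. -/
def dp (X : A) (n : ℕ) : A := (qintFact n)⁻¹ • X ^ n

/-- The `q`-binomial coefficient `C_q(X; c, n) = ∏_{s=1}^n (q^{c+1-s} X - 1)/(q^s - 1)`. -/
def Cq (X : A) (c : ℤ) : ℕ → A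
  | 0 => 1
  | n + 1 => (q ^ ((n : ℤ) + 1) - 1)⁻¹ • (Cq X c n * (q ^ (c - (n : ℤ)) • X - 1))

/-- The bracket `{X; c | n, r} = Σ_{s=0}^r q^{s(s+1)/2} binom_q(r,s) C_q(X; c+s, n-r)`. -/
def Sq (X : A) (c : ℤ) (n r : ℕ) : A :=
  ∑ s ∈ Finset.range (r + 1),
    (q ^ (s * (s + 1) / 2) * qBinom q r s) • Cq X (c + (s : ℤ)) (n - r)

end

theorem q_pow_ne_one {n : ℕ} (hn : n ≠ 0) : q ^ n ≠ 1 := by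
  intro h
  have h' : (Polynomial.X ^ n : Polynomial ℚ) = 1 := by
    apply RatFunc.algebraMap_injective ℚ
    simpa [q] using h
  have := congrArg Polynomial.natDegree h'
  simp at this
  exact hn this

theorem q_ne_zero : q ≠ 0 := RatFunc.X_ne_zero

theorem q_sub_one_ne_zero : q - 1 ≠ 0 := by
  simpa using sub_ne_zero.2 (q_pow_ne_one one_ne_zero)

theorem q_sub_inv_ne_zero : q - q⁻¹ ≠ 0 := by
  intro h
  apply q_pow_ne_one two_ne_zero
  have h0 := q_ne_zero
  field_simp at h
  linear_combination h

theorem qn_ne_zero {n : ℕ} (hn : n ≠ 0) : qn q n ≠ 0 :=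
  div_ne_zero (sub_ne_zero.2 (q_pow_ne_one hn)) q_sub_one_ne_zero

theorem qnFact_succ (x : K) (n : ℕ) : qnFact x (n + 1) = qnFact x n * qn x (n + 1) := by
  rw [qnFact, qnFact, Finset.prod_Icc_succ_top (by omega)]

theorem qnFact_ne_zero (n : ℕ) : qnFact q n ≠ 0 :=
  Finset.prod_ne_zero_iff.2 fun r hr => qn_ne_zero (by simp at hr; omega)

theorem qBinom_zero_right (n : ℕ) : qBinom q n 0 = 1 := by
  have h0 : qnFact q 0 = 1 := by simp [qnFact]
  simp [qBinom, h0, qnFact_ne_zero]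

theorem qBinom_self (n : ℕ) : qBinom q n n = 1 := by
  have h0 : qnFact q 0 = 1 := by simp [qnFact]
  simp [qBinom, h0, qnFact_ne_zero]

theorem qBinom_eq_zero {n s : ℕ} (h : n < s) : qBinom q n s = 0 := by
  simp [qBinom, h]

theorem qBinom_succ_succ (n s : ℕ) :
    qBinom q (n + 1) (s + 1) = qBinom q n s + q ^ (s + 1) * qBinom q n (s + 1) := by
  rcases lt_trichotomy n s with h | rfl | h
  · simp [qBinom_eq_zero, h, Nat.lt_succ_of_lt h]
  · simp [qBinom_self, qBinom_eq_zero]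
  · obtain ⟨j, rfl⟩ := Nat.exists_eq_add_of_lt h
    have e1 : s + j + 1 + 1 - (s + 1) = j + 1 := by omega
    have e2 : s + j + 1 - s = j + 1 := by omega
    have e3 : s + j + 1 - (s + 1) = j := by omega
    simp only [qBinom, e1, e2, e3, if_pos (show s + 1 ≤ s + j + 1 + 1 by omega),
      if_pos (show s ≤ s + j + 1 by omega), if_pos (show s + 1 ≤ s + j + 1 by omega)]
    rw [qnFact_succ q (s + j + 1), qnFact_succ q s, qnFact_succ q j]
    have hs := qnFact_ne_zero s
    have hj := qnFact_ne_zero j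
    have hs' := qn_ne_zero s.succ_ne_zero
    have hj' := qn_ne_zero j.succ_ne_zero
    have key : qn q (s + j + 1 + 1) = qn q (s + 1) + q ^ (s + 1) * qn q (j + 1) := by
      have := q_sub_one_ne_zero
      simp only [qn]
      field_simp
      ring
    rw [key]
    simp only [Nat.succ_eq_add_one] at hs' hj'
    field_simp

theorem sum_qBinom_succ {M : Type*} [AddCommGroup M] [Module K M] (k : ℕ) (F : ℕ → M) :
    ∑ s ∈ Finset.range (k + 2), (q ^ (s * (s + 1) / 2) * qBinom q (k + 1) s) • F s =
      ∑ s ∈ Finset.range (k + 1), (q ^ (s * (s + 1) / 2) * qBinom q k s) •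
        (q ^ s • F s + q ^ (s + 1) • F (s + 1)) := by
  have htop : ∑ s ∈ Finset.range (k + 1), (q ^ (s * (s + 1) / 2) * qBinom q k s) • q ^ s • F s =
      ∑ s ∈ Finset.range (k + 2), (q ^ (s * (s + 1) / 2) * qBinom q k s) • q ^ s • F s := by
    rw [Finset.sum_range_succ _ (k + 1)]
    simp [qBinom_eq_zero]
  simp only [smul_add, Finset.sum_add_distrib]
  rw [htop, Finset.sum_range_succ', Finset.sum_range_succ' _ (k + 1)]
  simp only [qBinom_zero_right, pow_zero, one_smul]
  rw [add_right_comm, ← Finset.sum_add_distrib]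
  congr 1
  refine Finset.sum_congr rfl fun s _ => ?_
  have htri : (s + 1) * (s + 1 + 1) / 2 = s * (s + 1) / 2 + (s + 1) := by
    rw [show (s + 1) * (s + 1 + 1) = s * (s + 1) + (s + 1) * 2 by ring,
      Nat.add_mul_div_right _ _ two_pos]
  rw [qBinom_succ_succ, htri, smul_smul, smul_smul, ← add_smul]
  congr 1
  ring

section Bracket

variable {R S : Type*} [Ring R] [Algebra K R] [Ring S] [Algebra K S]

theorem map_Cq (f : R →ₐ[K] S) (x : R) (c : ℤ) (n : ℕ) : f (Cq x c n) = Cq (f x) c n := by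
  induction n with
  | zero => simp [Cq]
  | succ n ih => simp [Cq, ih]

theorem map_Sq (f : R →ₐ[K] S) (x : R) (c : ℤ) (n r : ℕ) : f (Sq x c n r) = Sq (f x) c n r := by
  simp [Sq, map_Cq]

theorem Cq_smul (x : R) (j c : ℤ) (n : ℕ) : Cq (q ^ j • x) c n = Cq x (c + j) n := by
  induction n with
  | zero => rfl
  | succ n ih =>
    simp only [Cq, ih, smul_smul]
    rw [← zpow_add₀ q_ne_zero, show c - (n : ℤ) + j = c + j - n by ring]

theorem Sq_smul (x : R) (j c : ℤ) (n r : ℕ) : Sq (q ^ j • x) c n r = Sq x (c + j) n r := by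
  simp only [Sq, Cq_smul, add_right_comm]

end Bracket

section CommBracket

variable {R : Type*} [CommRing R] [Algebra K R]

theorem Cq_succ_eq_mul (x : R) (c : ℤ) (n : ℕ) :
    Cq x (c + 1) (n + 1) =
      (q ^ ((n : ℤ) + 1) - 1)⁻¹ • (Cq x c n * (q ^ (c + 1) • x - 1)) := by
  induction n with
  | zero => simp [Cq]
  | succ n ih =>
    rw [Cq, ih, Cq]
    have e : c + 1 - ((n + 1 : ℕ) : ℤ) = c - n := by push_cast; ring
    rw [e]
    simp only [smul_mul_assoc]
    rw [mul_right_comm]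

theorem Cq_add_one_sub (x : R) (c : ℤ) (n : ℕ) :
    Cq x (c + 1) (n + 1) - Cq x c (n + 1) = q ^ (c - n) • (x * Cq x c n) := by
  have h : q ^ ((n : ℤ) + 1) - 1 ≠ 0 := sub_ne_zero.2 (by exact_mod_cast q_pow_ne_one n.succ_ne_zero)
  have e : q ^ (c + 1) = q ^ (c - n) * q ^ ((n : ℤ) + 1) := by
    rw [← zpow_add₀ q_ne_zero]
    congr 1
    ring
  rw [Cq_succ_eq_mul, Cq, ← smul_sub, ← mul_sub, sub_sub_sub_cancel_right, ← sub_smul, e,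
    show q ^ (c - n) * q ^ ((n : ℤ) + 1) - q ^ (c - n) =
      (q ^ ((n : ℤ) + 1) - 1) * q ^ (c - n) by ring,
    mul_smul, mul_smul_comm, smul_smul, inv_mul_cancel₀ h, one_smul, mul_smul_comm, mul_comm x]

theorem Sq_add_two_sub (x : R) (t : ℤ) {n k : ℕ} (hk : k < n) :
    Sq x (t + 2) n k - Sq x t n k =
      q • (x * (q ^ (t + (k : ℤ) - n) • Sq x t n (k + 1))) := by
  obtain ⟨m, rfl⟩ := Nat.exists_eq_add_of_lt hk
  have e1 : k + m + 1 - k = m + 1 := by omega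
  have e2 : k + m + 1 - (k + 1) = m := by omega
  have hq := q_ne_zero
  simp only [Sq, e1, e2]
  rw [sum_qBinom_succ k fun s => Cq x (t + (s : ℤ)) m, ← Finset.sum_sub_distrib,
    Finset.smul_sum, Finset.mul_sum, Finset.smul_sum]
  refine Finset.sum_congr rfl fun s _ => ?_
  have h1 := Cq_add_one_sub x (t + s) m
  have h2 := Cq_add_one_sub x (t + s + 1) m
  have h : Cq x (t + 2 + (s : ℤ)) (m + 1) - Cq x (t + s) (m + 1) =
      q ^ (t + s + 1 - m) • (x * Cq x (t + s + 1) m) +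
        q ^ (t + (s : ℤ) - m) • (x * Cq x (t + s) m) := by
    rw [← h1, ← h2, show t + 2 + (s : ℤ) = t + s + 1 + 1 by ring]
    abel
  have e3 : q ^ (t + s + 1 - m) = q * (q ^ (t + (k : ℤ) - (k + m + 1 : ℕ)) * q ^ (s + 1)) := by
    rw [← zpow_natCast q (s + 1), ← zpow_add₀ hq, ← zpow_one_add₀ hq]
    congr 1
    push_cast
    ring
  have e4 : q ^ (t + (s : ℤ) - m) = q * (q ^ (t + (k : ℤ) - (k + m + 1 : ℕ)) * q ^ s) := by
    rw [← zpow_natCast q s, ← zpow_add₀ hq, ← zpow_one_add₀ hq]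
    congr 1
    push_cast
    ring
  rw [← smul_sub, h, e3, e4]
  have e5 : t + ((s + 1 : ℕ) : ℤ) = t + s + 1 := by push_cast; ring
  rw [e5]
  simp only [Algebra.smul_def, map_mul]
  ring

end CommBracket

section Commutator

open Polynomial

variable {R : Type*} [Ring R] [Algebra K R]

/-- If `a d - d a = (q - q⁻¹) z` with `a z = q² z a`, then commuting a polynomial in `a` with `d`
is given by the `q²`-difference quotient of that polynomial. -/
theorem exists_aeval_commutator {a d z : R} (hz : a * z = q ^ 2 • (z * a))
    (had : a * d - d * a = (q - q⁻¹) • z) (p : K[X]) :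
    ∃ r : K[X], aeval (q ^ 2 • (X : K[X])) p - p = q • (X * r) ∧
      aeval a p * d - d * aeval a p = z * aeval a r := by
  induction p using Polynomial.induction_on with
  | C x =>
    refine ⟨0, ?_, ?_⟩
    · simp [← Polynomial.algebraMap_eq]
    · simp [Algebra.commutes x d]
  | add p₁ p₂ h₁ h₂ =>
    obtain ⟨r₁, h₁, h₁'⟩ := h₁
    obtain ⟨r₂, h₂, h₂'⟩ := h₂
    refine ⟨r₁ + r₂, ?_, ?_⟩
    · rw [mul_add, smul_add, ← h₁, ← h₂, map_add]
      abel
    · rw [map_add, map_add, mul_add z, ← h₁', ← h₂']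
      noncomm_ring
  | monomial n x h =>
    rw [pow_succ' X n, mul_left_comm]
    generalize C x * X ^ n = p at h
    obtain ⟨r, h, h'⟩ := h
    refine ⟨q ^ 2 • (X * r) + (q - q⁻¹) • p, ?_, ?_⟩
    · rw [sub_eq_iff_eq_add] at h
      have hq : C q * C q⁻¹ = (1 : K[X]) := by
        rw [← C_mul, mul_inv_cancel₀ q_ne_zero, C_1]
      rw [map_mul, h, aeval_X]
      simp only [smul_eq_C_mul, C_pow, C_sub]
      linear_combination X * p * hq
    · rw [sub_eq_iff_eq_add] at h' had
      rw [map_mul, aeval_X, mul_assoc, h', mul_add, ← mul_assoc a z, hz, ← mul_assoc a d, had]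
      simp only [map_add, map_smul, map_mul, aeval_X, mul_add, add_mul, smul_mul_assoc,
        mul_smul_comm, mul_assoc]
      abel

theorem aeval_commutator {a d z : R} (hz : a * z = q ^ 2 • (z * a))
    (had : a * d - d * a = (q - q⁻¹) • z) {p r : K[X]}
    (h : aeval (q ^ 2 • (X : K[X])) p - p = q • (X * r)) :
    aeval a p * d - d * aeval a p = z * aeval a r := by
  obtain ⟨r', h₁, h₂⟩ := exists_aeval_commutator hz had p
  rw [h] at h₁
  rwa [mul_left_cancel₀ X_ne_zero (smul_right_injective _ q_ne_zero h₁)]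

end Commutator

theorem statement14 {A : Type*} [Ring A] [Algebra K A] (a b c d : A)
    (hab : a * b = (q : K) • (b * a)) (hac : a * c = (q : K) • (c * a))
    (hbd : b * d = (q : K) • (d * b)) (hcd : c * d = (q : K) • (d * c))
    (hbc : b * c = c * b)
    (hcomm : a * d - d * a = ((q - q⁻¹ : K)) • (b * c))
    (n : ℕ) (t : ℤ) (k : ℕ) (hk : k < n) :
    Sq a t n k * d - d * Sq a t n k =
      (q ^ (t + (k : ℤ) - (n : ℤ)) * (q - q⁻¹) ^ 2) •
        (((q - q⁻¹ : K)⁻¹ • c) * ((q - q⁻¹ : K)⁻¹ • b) * Sq a t n (k + 1)) := by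
  have hz : a * (b * c) = q ^ 2 • (b * c * a) := by
    rw [← mul_assoc, hab, smul_mul_assoc, mul_assoc, hac, mul_smul_comm, smul_smul, ← sq, mul_assoc]
  have hS : Polynomial.aeval (q ^ 2 • (Polynomial.X : Polynomial K)) (Sq (Polynomial.X : Polynomial K) t n k) -
      Sq (Polynomial.X : Polynomial K) t n k = q • ((Polynomial.X : Polynomial K) *
        (q ^ (t + (k : ℤ) - n) • Sq (Polynomial.X : Polynomial K) t n (k + 1))) := by
    rw [map_Sq, Polynomial.aeval_X, ← zpow_ofNat q 2, Sq_smul, Sq_add_two_sub _ _ hk]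
  have h := aeval_commutator hz hcomm hS
  rw [map_smul, map_Sq, map_Sq, Polynomial.aeval_X] at h
  have hq := q_sub_inv_ne_zero
  rw [h, hbc]
  simp only [smul_mul_assoc, mul_smul_comm, smul_smul]
  congr 1
  rw [mul_assoc, ← sq, inv_pow, mul_inv_cancel₀ (pow_ne_zero 2 hq), mul_one]
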